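/- Let C be an odd cycle of length 2ℓ+1 ≥ 5 in a graph G, chosen to be a shortest odd cycle, and let u be a vertex not on C with at least three neighbors on C. Then G contains a triangle. -/

import Mathlib

namespace SimpleGraph.Walk

variable {V : Type*} {G : SimpleGraph V}

theorem IsPath.isCycle_cons_concat {u x y : V} {p : G.Walk x y} (hp : p.IsPath) (hxy : x ≠ y)
    (hu : u ∉ p.support) (hx : G.Adj u x) (hy : G.Adj y u) :
    (cons hx (p.concat hy)).IsCycle := by
  rw [cons_isCycle_iff, concat_isPath_iff, edges_concat]
  refine ⟨⟨hp, hu⟩, fun h => ?_⟩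
  rw [List.concat_eq_append, List.mem_append, List.mem_singleton] at h
  rcases h with h | h
  · exact hu (p.fst_mem_support_of_mem_edges h)
  · rcases Sym2.eq_iff.mp h with ⟨rfl, rfl⟩ | ⟨-, rfl⟩ <;> exact hxy rfl

/-- A vertex outside a shortest odd cycle of length at least five cannot be adjacent to three
distinct vertices of it; here these vertices cut the cycle into the arcs `p`, `q`, `r`. -/
theorem IsCycle.false_of_shortest_odd_of_adj {a b d u : V}
    {p : G.Walk a b} {q : G.Walk b d} {r : G.Walk d a} (hc : (p.append (q.append r)).IsCycle)
    (hodd : Odd (p.append (q.append r)).length) (h5 : 5 ≤ (p.append (q.append r)).length)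
    (hmin : ∀ (w : V) (c : G.Walk w w), c.IsCycle → Odd c.length →
      (p.append (q.append r)).length ≤ c.length)
    (hu : u ∉ (p.append (q.append r)).support)
    (hab : a ≠ b) (had : a ≠ d) (hbd : b ≠ d)
    (hua : G.Adj u a) (hub : G.Adj u b) (hud : G.Adj u d) : False := by
  have key {x y : V} (s : G.Walk x y) (hs : s.IsPath) (hxy : x ≠ y) (hus : u ∉ s.support)
      (hx : G.Adj u x) (hy : G.Adj u y) :
      0 < s.length ∧ (Odd s.length → (p.append (q.append r)).length ≤ s.length + 2) := by
    refine ⟨Nat.pos_of_ne_zero fun h => hxy (eq_of_length_eq_zero h), fun h => ?_⟩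
    have := hmin u _ (hs.isCycle_cons_concat hxy hus hx hy.symm)
    simp only [length_cons, length_concat] at this
    exact this (by grind)
  simp only [mem_support_append_iff, not_or] at hu
  have hqr : (q.append r).IsPath := hc.isPath_of_append_right (not_nil_of_ne hab)
  have hp : p.IsPath :=
    hc.isPath_of_append_left (not_nil_of_ne (v := b) (w := a) hab.symm)
  have h₁ := key p hp hab hu.1 hua hub
  have h₂ := key q hqr.of_append_left hbd hu.2.1 hub hud
  have h₃ := key r hqr.of_append_right had.symm hu.2.2 hud hua
  simp only [length_append] at *
  grind

end SimpleGraph.Walk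


/-- If `C` is a shortest odd cycle of length `2ℓ+1 ≥ 5` and `u ∉ C` has at
least three neighbors on `C`, then the graph contains a triangle. -/
theorem triangle_of_three_neighbors_on_shortest_odd_cycle {V : Type*} (G : SimpleGraph V)
    (v : V) (ℓ : ℕ) (c : G.Walk v v)
    (hc : c.IsCycle) (hlen : c.length = 2 * ℓ + 1) (h5 : 5 ≤ c.length)
    (hmin : ∀ (w : V) (c' : G.Walk w w), c'.IsCycle → Odd c'.length → c.length ≤ c'.length)
    (u : V) (hu : u ∉ c.support)
    (a b d : V) (hab : a ≠ b) (had : a ≠ d) (hbd : b ≠ d)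
    (ha : a ∈ c.support) (hb : b ∈ c.support) (hd : d ∈ c.support)
    (hua : G.Adj u a) (hub : G.Adj u b) (hud : G.Adj u d) :
    ∃ x y z : V, G.Adj x y ∧ G.Adj y z ∧ G.Adj x z := by
  classical
  exfalso
  have hodd : Odd c.length := ⟨ℓ, hlen⟩
  obtain ⟨c', hc', hlen', hmem⟩ : ∃ c' : G.Walk a a, c'.IsCycle ∧ c'.length = c.length ∧
      ∀ x, x ∈ c'.support ↔ x ∈ c.support :=
    ⟨c.rotate a ha, hc.rotate ha, by simp, fun x => by simp⟩
  rw [← hlen'] at h5 hmin hodd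
  rw [← hmem] at hu hb hd
  clear hmem hlen' hlen ha hc c
  obtain ⟨p, q, rfl⟩ := SimpleGraph.Walk.mem_support_iff_exists_append.mp hb
  rcases (SimpleGraph.Walk.mem_support_append_iff _ _).mp hd with h | h
  · obtain ⟨p₁, p₂, rfl⟩ := SimpleGraph.Walk.mem_support_iff_exists_append.mp h
    rw [← SimpleGraph.Walk.append_assoc] at *
    exact hc'.false_of_shortest_odd_of_adj hodd h5 hmin hu had hab hbd.symm hua hud hub
  · obtain ⟨q₁, q₂, rfl⟩ := SimpleGraph.Walk.mem_support_iff_exists_append.mp h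
    exact hc'.false_of_shortest_odd_of_adj hodd h5 hmin hu hab had hbd hua hub hud
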